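/- Let p be a prime, ω ∈ ℂ a primitive p-th root of unity, and C₁, C₂ linear subspaces of (ZMod p)^n. For u, w ∈ (ZMod p)^n, the matrix X^u Z^w commutes with Z^h for every h ∈ C₁^⊥ and commutes with X^g for every g ∈ C₂^⊥ if and only if u ∈ C₁ and w ∈ C₂. -/

import Mathlib

open Matrix

/-- Dot product on `(ZMod p)^n`. -/
def dotp {p n : ℕ} (x y : Fin n → ZMod p) : ZMod p := ∑ i, x i * y i

/-- The dual of a set `C ⊆ (ZMod p)^n` with respect to the dot product. -/
def dualSet {p n : ℕ} (C : Set (Fin n → ZMod p)) : Set (Fin n → ZMod p) :=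
  {y | ∀ x ∈ C, dotp x y = 0}

/-- The matrix `X^u` on `ℂ^((ZMod p)^n)`: `X^u e_j = e_{j-u}`. -/
def XM (p n : ℕ) (u : Fin n → ZMod p) :
    Matrix (Fin n → ZMod p) (Fin n → ZMod p) ℂ :=
  Matrix.of fun i j => if i = j - u then 1 else 0

/-- The matrix `Z^w` on `ℂ^((ZMod p)^n)`: `Z^w e_j = ω^(w·j) e_j`, where `ω^a`
for `a : ZMod p` is interpreted via the representative `a.val`
(well defined since `ω^p = 1`). -/
def ZM (p n : ℕ) (ω : ℂ) (w : Fin n → ZMod p) :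
    Matrix (Fin n → ZMod p) (Fin n → ZMod p) ℂ :=
  Matrix.of fun i j => if i = j then ω ^ (dotp w j).val else 0

theorem pow_val_eq_iff {p : ℕ} [NeZero p] {ω : ℂ} (hω : IsPrimitiveRoot ω p) (a b : ZMod p) :
    ω ^ a.val = ω ^ b.val ↔ a = b :=
  ⟨fun h => ZMod.val_injective p (hω.pow_inj (ZMod.val_lt a) (ZMod.val_lt b) h), fun h => h ▸ rfl⟩

theorem dotp_sub {p n : ℕ} (x y z : Fin n → ZMod p) : dotp x (y - z) = dotp x y - dotp x z :=
  dotProduct_sub x y z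

theorem dotp_comm {p n : ℕ} (x y : Fin n → ZMod p) : dotp x y = dotp y x :=
  dotProduct_comm x y

/-- A subspace is its own double dual. -/
theorem forall_mem_dualSet_dotp_eq_zero_iff {p n : ℕ} [Fact p.Prime]
    (C : Submodule (ZMod p) (Fin n → ZMod p)) (u : Fin n → ZMod p) :
    (∀ h ∈ dualSet (C : Set (Fin n → ZMod p)), dotp h u = 0) ↔ u ∈ C := by
  refine ⟨fun H => ?_, fun hu h hh => by rw [dotp_comm]; exact hh u hu⟩
  by_contra hu
  obtain ⟨f, hfu, hfC⟩ := Submodule.exists_le_ker_of_notMem hu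
  have hf : ∀ x, dotp x (fun i => f (Pi.single i 1)) = f x := fun x => by
    conv_rhs => rw [pi_eq_sum_univ' x, map_sum]
    simp only [dotp, map_smul, smul_eq_mul, Pi.single]
  refine hfu ?_
  rw [← hf, dotp_comm]
  exact H _ fun x hx => by rw [hf]; exact hfC hx

theorem XM_mul_ZM_apply {p n : ℕ} [NeZero p] (ω : ℂ) (u w i j : Fin n → ZMod p) :
    (XM p n u * ZM p n ω w) i j = if i = j - u then ω ^ (dotp w j).val else 0 := by
  simp [Matrix.mul_apply, XM, ZM]

theorem XM_mul_ZM_commute_ZM_iff {p n : ℕ} [NeZero p] {ω : ℂ} (hω : IsPrimitiveRoot ω p)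
    (u w h : Fin n → ZMod p) :
    (XM p n u * ZM p n ω w) * ZM p n ω h = ZM p n ω h * (XM p n u * ZM p n ω w) ↔
      dotp h u = 0 := by
  have hω0 : ω ≠ 0 := hω.ne_zero (NeZero.ne p)
  have hl (i j) : ((XM p n u * ZM p n ω w) * ZM p n ω h) i j =
      if i = j - u then ω ^ (dotp w j).val * ω ^ (dotp h j).val else 0 := by
    rw [Matrix.mul_apply]
    simp only [XM_mul_ZM_apply]
    simp [ZM]
  have hr (i j) : (ZM p n ω h * (XM p n u * ZM p n ω w)) i j =
      if i = j - u then ω ^ (dotp w j).val * ω ^ (dotp h (j - u)).val else 0 := by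
    rw [Matrix.mul_apply]
    simp only [XM_mul_ZM_apply]
    simp [ZM, mul_comm]
  constructor
  · intro H
    have := congrFun (congrFun H (u - u)) u
    rw [hl, hr, if_pos rfl, if_pos rfl, mul_right_inj' (pow_ne_zero _ hω0),
      pow_val_eq_iff hω, dotp_sub, sub_self] at this
    exact this
  · intro H
    ext i j
    rw [hl, hr, dotp_sub, H, sub_zero]

theorem XM_mul_ZM_commute_XM_iff {p n : ℕ} [NeZero p] {ω : ℂ} (hω : IsPrimitiveRoot ω p)
    (u w g : Fin n → ZMod p) :
    (XM p n u * ZM p n ω w) * XM p n g = XM p n g * (XM p n u * ZM p n ω w) ↔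
      dotp g w = 0 := by
  have hl (i j) : ((XM p n u * ZM p n ω w) * XM p n g) i j =
      if i = j - g - u then ω ^ (dotp w (j - g)).val else 0 := by
    rw [Matrix.mul_apply]
    simp only [XM_mul_ZM_apply]
    simp [XM]
  have hr (i j) : (XM p n g * (XM p n u * ZM p n ω w)) i j =
      if i = j - g - u then ω ^ (dotp w j).val else 0 := by
    rw [Matrix.mul_apply]
    simp only [XM_mul_ZM_apply]
    simp only [XM, Matrix.of_apply, eq_sub_iff_add_eq, ite_mul, one_mul, zero_mul,
      Finset.sum_ite_eq, Finset.mem_univ, if_true, add_right_comm i g u]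
  rw [dotp_comm]
  constructor
  · intro H
    have := congrFun (congrFun H (g - g - u)) g
    rw [hl, hr, if_pos rfl, if_pos rfl, pow_val_eq_iff hω, dotp_sub, sub_self] at this
    exact this.symm
  · intro H
    ext i j
    rw [hl, hr, dotp_sub, H, sub_zero]

/-- `X^u Z^w` commutes with `Z^h` for every `h ∈ C₁^⊥` and with `X^g` for
every `g ∈ C₂^⊥` if and only if `u ∈ C₁` and `w ∈ C₂`. -/
theorem stmt13 (p n : ℕ) [Fact p.Prime] (ω : ℂ) (hω : IsPrimitiveRoot ω p)
    (C₁ C₂ : Submodule (ZMod p) (Fin n → ZMod p))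
    (u w : Fin n → ZMod p) :
    ((∀ h ∈ dualSet (C₁ : Set (Fin n → ZMod p)),
        (XM p n u * ZM p n ω w) * ZM p n ω h =
          ZM p n ω h * (XM p n u * ZM p n ω w)) ∧
      (∀ g ∈ dualSet (C₂ : Set (Fin n → ZMod p)),
        (XM p n u * ZM p n ω w) * XM p n g =
          XM p n g * (XM p n u * ZM p n ω w))) ↔
    (u ∈ C₁ ∧ w ∈ C₂) := by
  simp only [XM_mul_ZM_commute_ZM_iff hω, XM_mul_ZM_commute_XM_iff hω,
    forall_mem_dualSet_dotp_eq_zero_iff]
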